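/- arXiv:1807.10694 — 2 statements merged into one kernel-verified Lean document; each statement's English description precedes it below -/
import Mathlib

section
/- Fix S ∈ 𝒮* := ∩_{t=0}^T 𝒮_t. Then the family (π_t^S)_{t=0}^T is time consistent (for all t < s and X,Y ∈ L^∞_d(F): π_s^S(X) ≤ π_s^S(Y) implies π_t^S(X) ≤ π_t^S(Y)) if and only if the family (φ_t^S)_{t=0}^T, φ_t^S(Z) := π_t^S(Z e_1), is time consistent in the usual univariate sense (for all t < s and Z_1,Z_2 ∈ L^∞(F): φ_s^S(Z_1) ≤ φ_s^S(Z_2) implies φ_t^S(Z_1) ≤ φ_t^S(Z_2)). -/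
open MeasureTheory Filter Set
open scoped ENNReal

noncomputable section

namespace RiskPaper

variable {Ω : Type*}

/-- Euclidean inner product on `Fin d → ℝ`. -/
def dot {d : ℕ} (x y : Fin d → ℝ) : ℝ := ∑ i, x i * y i

/-- The first unit vector `e₁ = (1,0,…,0) ∈ ℝ^d`. -/
def e1 (d : ℕ) : Fin d → ℝ := fun i => if (i : ℕ) = 0 then 1 else 0

/-- The `i`-th unit vector of `ℝ^d`. -/
def eVec {d : ℕ} (i : Fin d) : Fin d → ℝ := fun j => if j = i then 1 else 0

/-- Measurability with respect to an explicitly given σ-algebra on the domain. -/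
def MeasF {α : Type*} [MeasurableSpace α] (m : MeasurableSpace Ω) (f : Ω → α) : Prop :=
  @Measurable Ω α m _ f

/-- `L^∞_d(F_t)`: bounded `F_t`-measurable `ℝ^d`-valued random variables
(pointwise representatives). -/
def LinfD (F : ℕ → MeasurableSpace Ω) (d t : ℕ) : Set (Ω → Fin d → ℝ) :=
  {X | MeasF (F t) X ∧ ∃ C : ℝ, ∀ ω i, |X ω i| ≤ C}

/-- `L^∞(F_t)`: bounded `F_t`-measurable scalar random variables. -/
def Linf (F : ℕ → MeasurableSpace Ω) (t : ℕ) : Set (Ω → ℝ) :=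
  {x | MeasF (F t) x ∧ ∃ C : ℝ, ∀ ω, |x ω| ≤ C}

/-- The eligible space `M_t = L^∞(F_t) × {0}^{d-1}` (portfolios held in the first asset). -/
def Mt (F : ℕ → MeasurableSpace Ω) (d t : ℕ) : Set (Ω → Fin d → ℝ) :=
  {m | m ∈ LinfD F d t ∧ ∀ ω, ∀ i : Fin d, (i : ℕ) ≠ 0 → m ω i = 0}

/-- The nonnegative elements `M_{t,+}` of `M_t`. -/
def MtPlus (F : ℕ → MeasurableSpace Ω) (d t : ℕ) : Set (Ω → Fin d → ℝ) :=
  {m | m ∈ Mt F d t ∧ ∀ ω i, 0 ≤ m ω i}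

/-- Structural assumptions on the filtration `(F_t)_{t=0}^T`: increasing, contained in the
ambient σ-algebra, `F_T` equal to the ambient σ-algebra, and `F_0` `P`-trivial. -/
def FiltrationOK [m0 : MeasurableSpace Ω] (F : ℕ → MeasurableSpace Ω) (P : Measure Ω)
    (T : ℕ) : Prop :=
  (∀ s t : ℕ, s ≤ t → F s ≤ F t) ∧ (∀ t, F t ≤ m0) ∧ F T = m0 ∧
    ∀ A : Set Ω, MeasurableSet[F 0] A → P A = 0 ∨ P A = 1

section Meas
variable [MeasurableSpace Ω]

/-- `g` is (a version of) the essential infimum of the set `A` of random variables. -/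
def IsEssInfSet (P : Measure Ω) (A : Set (Ω → ℝ)) (g : Ω → ℝ) : Prop :=
  (∀ f ∈ A, ∀ᵐ ω ∂P, g ω ≤ f ω) ∧
    ∀ h : Ω → ℝ, (∀ f ∈ A, ∀ᵐ ω ∂P, h ω ≤ f ω) → ∀ᵐ ω ∂P, h ω ≤ g ω

/-- `g` is (a version of) the essential supremum of the set `A` of random variables. -/
def IsEssSupSet (P : Measure Ω) (A : Set (Ω → ℝ)) (g : Ω → ℝ) : Prop :=
  (∀ f ∈ A, ∀ᵐ ω ∂P, f ω ≤ g ω) ∧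
    ∀ h : Ω → ℝ, (∀ f ∈ A, ∀ᵐ ω ∂P, f ω ≤ h ω) → ∀ᵐ ω ∂P, g ω ≤ h ω

/-- Essential supremum of a set of extended-real-valued random variables
(to accommodate the values `±∞`). -/
def IsEssSupSetE (P : Measure Ω) (A : Set (Ω → EReal)) (g : Ω → EReal) : Prop :=
  (∀ f ∈ A, ∀ᵐ ω ∂P, f ω ≤ g ω) ∧
    ∀ h : Ω → EReal, (∀ f ∈ A, ∀ᵐ ω ∂P, f ω ≤ h ω) → ∀ᵐ ω ∂P, g ω ≤ h ω

/-- Essential infimum of a set of extended-real-valued random variables. -/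
def IsEssInfSetE (P : Measure Ω) (A : Set (Ω → EReal)) (g : Ω → EReal) : Prop :=
  (∀ f ∈ A, ∀ᵐ ω ∂P, g ω ≤ f ω) ∧
    ∀ h : Ω → EReal, (∀ f ∈ A, ∀ᵐ ω ∂P, h ω ≤ f ω) → ∀ᵐ ω ∂P, h ω ≤ g ω

/-- An (extended-real-valued) random variable lies in `L^∞(F_t)`:
it agrees `P`-a.s. with a bounded `F_t`-measurable real random variable. -/
def MemLinfE (F : ℕ → MeasurableSpace Ω) (P : Measure Ω) (t : ℕ) (g : Ω → EReal) : Prop :=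
  ∃ x ∈ Linf F t, g =ᵐ[P] fun ω => (x ω : EReal)

/-- The Radon–Nikodym density `dQ/dP` as a real random variable. -/
def rnd (P Q : Measure Ω) : Ω → ℝ := fun ω => (Q.rnDeriv P ω).toReal

/-- `ξ̄_{t,T}(Q) = (dQ/dP)/E[dQ/dP | F_t]` on `{E[dQ/dP|F_t] > 0}` and `1` elsewhere. -/
def xiBar (F : ℕ → MeasurableSpace Ω) (P Q : Measure Ω) (t : ℕ) : Ω → ℝ := fun ω =>
  if 0 < (P[rnd P Q | F t]) ω then rnd P Q ω / (P[rnd P Q | F t]) ω else 1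

/-- The `P`-a.s. version of the conditional expectation `E^Q[x | F_t]`, defined as
`E[ξ̄_{t,T}(Q) x | F_t]`. -/
def EQcond (F : ℕ → MeasurableSpace Ω) (P Q : Measure Ω) (t : ℕ) (x : Ω → ℝ) : Ω → ℝ :=
  P[fun ω => xiBar F P Q t ω * x ω | F t]

end Meas

/-- The solvency regions are closed convex cones (pointwise in `ω`). -/
def ConesOK {d : ℕ} (K : ℕ → Ω → Set (Fin d → ℝ)) : Prop :=
  ∀ s (ω : Ω), IsClosed (K s ω) ∧ Convex ℝ (K s ω) ∧
    (0 : Fin d → ℝ) ∈ K s ω ∧ ∀ c : ℝ, 0 ≤ c → ∀ x ∈ K s ω, c • x ∈ K s ω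

/-- The trading set `𝕂_t = Σ_{s=t}^T L^∞_d(F_s; K_s)`. -/
def KK (F : ℕ → MeasurableSpace Ω) (d T : ℕ) (K : ℕ → Ω → Set (Fin d → ℝ)) (t : ℕ) :
    Set (Ω → Fin d → ℝ) :=
  {X | ∃ k : ℕ → Ω → Fin d → ℝ,
      (∀ s, t ≤ s → s ≤ T → k s ∈ LinfD F d s ∧ ∀ ω, k s ω ∈ K s ω) ∧
      ∀ ω, X ω = ∑ s ∈ Finset.Icc t T, k s ω}

/-- Assumption 2.2 of the paper: `K_T ⊇ K̄` a.s. for a convex cone `K̄` with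
`int K̄ ⊇ ℝ^d_+ \ {0}`. -/
def FrictionAssumption [MeasurableSpace Ω] (P : Measure Ω) {d : ℕ} (T : ℕ)
    (K : ℕ → Ω → Set (Fin d → ℝ)) : Prop :=
  ∃ Kbar : Set (Fin d → ℝ), Convex ℝ Kbar ∧
    (∀ c : ℝ, 0 ≤ c → ∀ x ∈ Kbar, c • x ∈ Kbar) ∧
    {x : Fin d → ℝ | (∀ i, 0 ≤ x i) ∧ x ≠ 0} ⊆ interior Kbar ∧
    ∀ᵐ ω ∂P, Kbar ⊆ K T ω

/-- The norm `‖x‖_{𝕂_T,0}` for a deterministic portfolio `x ∈ ℝ^d`: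
`inf{c ∈ ℝ : c e₁ − x ∈ 𝕂_T, x + c e₁ ∈ 𝕂_T}`. -/
def normKT0 (F : ℕ → MeasurableSpace Ω) (d T : ℕ) (K : ℕ → Ω → Set (Fin d → ℝ))
    (x : Fin d → ℝ) : ℝ :=
  sInf {c : ℝ | (fun (_ : Ω) i => c * e1 d i - x i) ∈ KK F d T K T ∧
      (fun (_ : Ω) i => x i + c * e1 d i) ∈ KK F d T K T}

/-- The positive dual cone of a set `C ⊆ ℝ^d`. -/
def dualCone {d : ℕ} (C : Set (Fin d → ℝ)) : Set (Fin d → ℝ) := {y | ∀ x ∈ C, 0 ≤ dot x y}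

section MeasP
variable [MeasurableSpace Ω]

/-- The positive dual cone `𝕂_t^+ ⊆ L^1_d` of the trading set `𝕂_t`. -/
def KKplus (F : ℕ → MeasurableSpace Ω) (P : Measure Ω) (d T : ℕ)
    (K : ℕ → Ω → Set (Fin d → ℝ)) (t : ℕ) : Set (Ω → Fin d → ℝ) :=
  {v | (∀ i : Fin d, Integrable (fun ω => v ω i) P) ∧
      ∀ u ∈ KK F d T K t, 0 ≤ ∫ ω, dot (v ω) (u ω) ∂P}

/-- `(Q,S) ∈ 𝒬_t`: `Q ≪ P` a probability measure and `(S_s)_{s=t}^T` a consistent pricing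
process with `S_{s,1} ≡ 1`, the `L^∞` bound `‖S_{s,i}‖_∞ ≤ max{‖e_i‖_{𝕂_T,0},1}`,
`S_s = E^Q[S_T | F_s]` and `(dQ/dP) S_T ∈ 𝕂_t^+`. -/
def memQt (F : ℕ → MeasurableSpace Ω) (P : Measure Ω) (d T : ℕ)
    (K : ℕ → Ω → Set (Fin d → ℝ)) (t : ℕ) (Q : Measure Ω) (S : ℕ → Ω → Fin d → ℝ) : Prop :=
  IsProbabilityMeasure Q ∧ Q ≪ P ∧
    (∀ s, t ≤ s → s ≤ T →
      S s ∈ LinfD F d s ∧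
      (∀ ω, ∀ i : Fin d, (i : ℕ) = 0 → S s ω i = 1) ∧
      (∀ i : Fin d, ∀ ω, |S s ω i| ≤ max (normKT0 F d T K (eVec i)) 1) ∧
      ∀ i : Fin d, (fun ω => S s ω i) =ᵐ[P] EQcond F P Q s fun ω => S T ω i) ∧
    (fun ω i => rnd P Q ω * S T ω i) ∈ KKplus F P d T K t

/-- `(Q,S) ∈ 𝒬_t^e`: additionally `Q` is equivalent to `P`. -/
def memQtE (F : ℕ → MeasurableSpace Ω) (P : Measure Ω) (d T : ℕ)
    (K : ℕ → Ω → Set (Fin d → ℝ)) (t : ℕ) (Q : Measure Ω) (S : ℕ → Ω → Fin d → ℝ) : Prop :=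
  memQt F P d T K t Q S ∧ P ≪ Q

/-- The set `𝒮` of eligible (frictionless) pricing processes. -/
def memS (F : ℕ → MeasurableSpace Ω) (d T : ℕ) (K : ℕ → Ω → Set (Fin d → ℝ))
    (S : ℕ → Ω → Fin d → ℝ) : Prop :=
  ∀ t ≤ T, S t ∈ LinfD F d t ∧ (∀ ω, S t ω ∈ dualCone (K t ω)) ∧
    (∀ ω, ∀ i : Fin d, (i : ℕ) = 0 → S t ω i = 1) ∧
    ∀ i : Fin d, ∀ ω, |S t ω i| ≤ max (normKT0 F d T K (eVec i)) 1

/-- `Q ∈ 𝒬^e(S)`: `Q` is a probability measure equivalent to `P` under which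
`S` is a martingale (with the `P`-a.s. version of conditional expectations). -/
def QeS (F : ℕ → MeasurableSpace Ω) (P : Measure Ω) (d T : ℕ)
    (S : ℕ → Ω → Fin d → ℝ) : Set (Measure Ω) :=
  {Q | IsProbabilityMeasure Q ∧ Q ≪ P ∧ P ≪ Q ∧
    ∀ s ≤ T, ∀ i : Fin d, (fun ω => S s ω i) =ᵐ[P] EQcond F P Q s fun ω => S T ω i}

/-- The cone `Γ_t(S_t) = {Z ∈ L^∞_d(F_t) : S_t^⊤ Z ≥ 0 a.s.}`. -/
def Gamma (F : ℕ → MeasurableSpace Ω) (P : Measure Ω) (d : ℕ)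
    (S : ℕ → Ω → Fin d → ℝ) (t : ℕ) : Set (Ω → Fin d → ℝ) :=
  {Z | Z ∈ LinfD F d t ∧ ∀ᵐ ω ∂P, 0 ≤ dot (S t ω) (Z ω)}

/-- The set `Σ_{s=0}^T Γ_s(S_s)` of claims attainable from zero. -/
def SumGamma (F : ℕ → MeasurableSpace Ω) (P : Measure Ω) (d T : ℕ)
    (S : ℕ → Ω → Fin d → ℝ) : Set (Ω → Fin d → ℝ) :=
  {X | ∃ Z : ℕ → Ω → Fin d → ℝ, (∀ s ≤ T, Z s ∈ Gamma F P d S s) ∧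
      ∀ ω, X ω = ∑ s ∈ Finset.range (T + 1), Z s ω}

/-- The no-arbitrage condition (NA):
`[Σ_{s=0}^T Γ_s(S_s)] ∩ [−Γ_T(S_T)] ⊆ Γ_T(S_T)`. -/
def NoArb (F : ℕ → MeasurableSpace Ω) (P : Measure Ω) (d T : ℕ)
    (S : ℕ → Ω → Fin d → ℝ) : Prop :=
  ∀ X ∈ SumGamma F P d T S, (fun ω => -X ω) ∈ Gamma F P d S T → X ∈ Gamma F P d S T

/-- `ρ_t` is a scalarized conditional convex risk measure: finite (`L^∞(F_t)`-valued),
conditionally cash invariant in the first asset, monotone, conditionally convex. -/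
structure ScalarRM (F : ℕ → MeasurableSpace Ω) (P : Measure Ω) (d T t : ℕ)
    (rho : (Ω → Fin d → ℝ) → Ω → ℝ) : Prop where
  finite : ∀ X ∈ LinfD F d T, ∃ g ∈ Linf F t, rho X =ᵐ[P] g
  cash : ∀ X ∈ LinfD F d T, ∀ m ∈ Linf F t,
    rho (fun ω => X ω + m ω • e1 d) =ᵐ[P] fun ω => rho X ω - m ω
  mono : ∀ X ∈ LinfD F d T, ∀ Y ∈ LinfD F d T,
    (∀ ω i, X ω i ≤ Y ω i) → rho Y ≤ᵐ[P] rho X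
  convex : ∀ X ∈ LinfD F d T, ∀ Y ∈ LinfD F d T, ∀ lam ∈ Linf F t,
    (∀ ω, lam ω ∈ Set.Icc (0 : ℝ) 1) →
    rho (fun ω => lam ω • X ω + (1 - lam ω) • Y ω) ≤ᵐ[P]
      fun ω => lam ω * rho X ω + (1 - lam ω) * rho Y ω

/-- Conditional positive homogeneity (coherence). -/
def CoherentRM (F : ℕ → MeasurableSpace Ω) (P : Measure Ω) (d T t : ℕ)
    (rho : (Ω → Fin d → ℝ) → Ω → ℝ) : Prop :=
  ∀ X ∈ LinfD F d T, ∀ lam ∈ Linf F t, (∀ ω, 0 ≤ lam ω) →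
    rho (fun ω => lam ω • X ω) =ᵐ[P] fun ω => lam ω * rho X ω

/-- `𝕂_t`-compatibility of a scalar risk measure:
`ρ_t(X) = essinf_{k ∈ 𝕂_t} ρ_t(X−k)`. -/
def KCompat (F : ℕ → MeasurableSpace Ω) (P : Measure Ω) (d T : ℕ)
    (K : ℕ → Ω → Set (Fin d → ℝ)) (t : ℕ) (rho : (Ω → Fin d → ℝ) → Ω → ℝ) : Prop :=
  ∀ X ∈ LinfD F d T,
    IsEssInfSet P {g | ∃ k ∈ KK F d T K t, g = rho fun ω => X ω - k ω} (rho X)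

/-- The acceptance set `A_t = {X ∈ L^∞_d(F) : ρ_t(X) ≤ 0}`. -/
def Acc (F : ℕ → MeasurableSpace Ω) (P : Measure Ω) (d T : ℕ)
    (rho : (Ω → Fin d → ℝ) → Ω → ℝ) : Set (Ω → Fin d → ℝ) :=
  {X | X ∈ LinfD F d T ∧ ∀ᵐ ω ∂P, rho X ω ≤ 0}

/-- `β` is (a version of) the penalty function
`β_t(Q,S) = esssup_{Z ∈ A} −E^Q[S_T^⊤ Z | F_t]`. -/
def IsPenalty (F : ℕ → MeasurableSpace Ω) (P : Measure Ω) (d T t : ℕ)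
    (A : Set (Ω → Fin d → ℝ)) (Q : Measure Ω) (S : ℕ → Ω → Fin d → ℝ)
    (beta : Ω → EReal) : Prop :=
  IsEssSupSetE P
    {g | ∃ Z ∈ A, g = fun ω =>
      ((-(EQcond F P Q t (fun ω' => dot (S T ω') (Z ω')) ω) : ℝ) : EReal)} beta

/-- `g` is (a version of) `π_t^S(X) = esssup_{Q ∈ 𝒬^e(S)} (−β_t(Q,S) − E^Q[S_T^⊤ X|F_t])`. -/
def IsPi (F : ℕ → MeasurableSpace Ω) (P : Measure Ω) (d T t : ℕ)
    (beta : Measure Ω → Ω → EReal) (S : ℕ → Ω → Fin d → ℝ) (X : Ω → Fin d → ℝ)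
    (g : Ω → EReal) : Prop :=
  IsEssSupSetE P
    {h | ∃ Q ∈ QeS F P d T S, h = fun ω =>
      -beta Q ω - ((EQcond F P Q t (fun ω' => dot (S T ω') (X ω')) ω : ℝ) : EReal)} g

/-- The Fatou property of `ρ_t`. -/
def Fatou (F : ℕ → MeasurableSpace Ω) (P : Measure Ω) (d T : ℕ)
    (rho : (Ω → Fin d → ℝ) → Ω → ℝ) : Prop :=
  ∀ X ∈ LinfD F d T, ∀ Xn : ℕ → Ω → Fin d → ℝ, (∀ n, Xn n ∈ LinfD F d T) →
    (∃ C : ℝ, ∀ n ω i, |Xn n ω i| ≤ C) →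
    (∀ᵐ ω ∂P, Tendsto (fun n => Xn n ω) atTop (nhds (X ω))) →
    ∀ᵐ ω ∂P, rho X ω ≤ atTop.liminf fun n => rho (Xn n) ω

/-- Relevance (sensitivity): `P(ρ_t(−ε 1_D e₁) > ρ_t(0)) > 0` for all `ε > 0` and all
`D ∈ F` with positive probability. -/
def Relevant (P : Measure Ω) (d : ℕ) (rho : (Ω → Fin d → ℝ) → Ω → ℝ) : Prop :=
  ∀ ε : ℝ, 0 < ε → ∀ D : Set Ω, MeasurableSet D → 0 < P D →
    0 < P {ω | rho (fun _ _ => 0) ω <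
      rho (fun ω' => (-(ε * D.indicator (fun _ => (1 : ℝ)) ω')) • e1 d) ω}

end MeasP
/-- Valuing the cash position `dot s x • e1 d` at prices `s` with numéraire price `1` returns
the value `dot s x`. -/
lemma dot_smul_e1 {d : ℕ} (s x : Fin d → ℝ) (hs : ∀ i : Fin d, (i : ℕ) = 0 → s i = 1) :
    dot s (dot s x • e1 d) = dot s x := by
  cases d with
  | zero => simp [dot]
  | succ n =>
    conv_lhs => rw [dot, Fin.sum_univ_succ]
    simp [e1, hs 0 rfl]

lemma smul_e1_mem_LinfD {F : ℕ → MeasurableSpace Ω} {d t : ℕ} {Z : Ω → ℝ} (hZ : Z ∈ Linf F t) :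
    (fun ω => Z ω • e1 d) ∈ LinfD F d t := by
  obtain ⟨hm, C, hC⟩ := hZ
  refine ⟨?_, C, fun ω i => ?_⟩
  · have hm' : Measurable[F t] Z := hm
    exact @measurable_pi_lambda _ _ _ (F t) _ _ fun i => hm'.mul_const (e1 d i)
  · have hnonneg : 0 ≤ C := (abs_nonneg _).trans (hC ω)
    by_cases h : (i : ℕ) = 0
    · simpa [e1, h] using hC ω
    · simpa [e1, h] using hnonneg

lemma dot_mem_Linf {F : ℕ → MeasurableSpace Ω} {d t : ℕ} {X Y : Ω → Fin d → ℝ}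
    (hX : X ∈ LinfD F d t) (hY : Y ∈ LinfD F d t) :
    (fun ω => dot (X ω) (Y ω)) ∈ Linf F t := by
  obtain ⟨hXm, C, hC⟩ := hX
  obtain ⟨hYm, D, hD⟩ := hY
  have hXm' : Measurable[F t] X := hXm
  have hYm' : Measurable[F t] Y := hYm
  refine ⟨?_, ∑ _i : Fin d, C * D, fun ω => ?_⟩
  · exact Finset.measurable_fun_sum Finset.univ fun i _ =>
      ((measurable_pi_apply i).comp hXm').mul ((measurable_pi_apply i).comp hYm')
  · refine (Finset.abs_sum_le_sum_abs _ _).trans (Finset.sum_le_sum fun i _ => ?_)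
    rw [abs_mul]
    exact mul_le_mul (hC ω i) (hD ω i) (abs_nonneg _) ((abs_nonneg _).trans (hC ω i))

lemma IsEssSupSetE.ae_eq [MeasurableSpace Ω] {P : Measure Ω} {A : Set (Ω → EReal)}
    {g h : Ω → EReal} (hg : IsEssSupSetE P A g) (hh : IsEssSupSetE P A h) : g =ᵐ[P] h := by
  filter_upwards [hg.2 h hh.1, hh.2 g hg.1] with ω h₁ h₂ using le_antisymm h₁ h₂

/-- `π_t^S(X)` depends on `X` only through its terminal value `S_T^⊤ X`. -/
lemma IsPi.ae_eq_of_dot_eq [MeasurableSpace Ω] {F : ℕ → MeasurableSpace Ω} {P : Measure Ω}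
    {d T t : ℕ} {beta : Measure Ω → Ω → EReal} {S : ℕ → Ω → Fin d → ℝ}
    {X Y : Ω → Fin d → ℝ} {g h : Ω → EReal} (hg : IsPi F P d T t beta S X g)
    (hh : IsPi F P d T t beta S Y h) (hXY : ∀ ω, dot (S T ω) (X ω) = dot (S T ω) (Y ω)) :
    g =ᵐ[P] h := by
  unfold IsPi at hg hh
  simp only [hXY] at hg
  exact hg.ae_eq hh

/-- Proposition 6.3.  Fix `S ∈ 𝒮* = ∩_t 𝒮_t`.  The family `(π_t^S)_t`
is time consistent iff the family of univariate risk measures `(φ_t^S)_t`,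
`φ_t^S(Z) = π_t^S(Z e₁)`, is time consistent in the usual univariate sense. -/
theorem statement13 [MeasurableSpace Ω] (F : ℕ → MeasurableSpace Ω) (P : Measure Ω)
    [IsProbabilityMeasure P] (d T : ℕ) (K : ℕ → Ω → Set (Fin d → ℝ))
    (hFil : FiltrationOK F P T) (hK : ConesOK K) (hKbar : FrictionAssumption P T K)
    (rho : ℕ → (Ω → Fin d → ℝ) → Ω → ℝ)
    (hrho : ∀ r ≤ T, ScalarRM F P d T r (rho r) ∧ KCompat F P d T K r (rho r) ∧
      Fatou F P d T (rho r) ∧ Relevant P d (rho r))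
    (S : ℕ → Ω → Fin d → ℝ) (hS : memS F d T K S)
    (beta : ℕ → Measure Ω → Ω → EReal)
    (hbeta : ∀ r ≤ T, ∀ Q ∈ QeS F P d T S,
      IsPenalty F P d T r (Acc F P d T (rho r)) Q S (beta r Q))
    (pi : ℕ → (Ω → Fin d → ℝ) → Ω → EReal)
    (hpi : ∀ r ≤ T, ∀ X ∈ LinfD F d T, IsPi F P d T r (beta r) S X (pi r X))
    -- `S ∈ 𝒮*`:
    (hSstar : ∀ r ≤ T, MemLinfE F P r (pi r fun _ _ => 0)) :
    -- `(π_t^S)_t` is time consistent …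
    (∀ t s : ℕ, t < s → s ≤ T → ∀ X ∈ LinfD F d T, ∀ Y ∈ LinfD F d T,
      pi s X ≤ᵐ[P] pi s Y → pi t X ≤ᵐ[P] pi t Y) ↔
    -- … iff `(φ_t^S)_t` is time consistent:
    (∀ t s : ℕ, t < s → s ≤ T → ∀ Z₁ ∈ Linf F T, ∀ Z₂ ∈ Linf F T,
      pi s (fun ω => Z₁ ω • e1 d) ≤ᵐ[P] pi s (fun ω => Z₂ ω • e1 d) →
        pi t (fun ω => Z₁ ω • e1 d) ≤ᵐ[P] pi t fun ω => Z₂ ω • e1 d) := by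
  constructor
  · intro h t s hts hsT Z₁ hZ₁ Z₂ hZ₂
    exact h t s hts hsT _ (smul_e1_mem_LinfD hZ₁) _ (smul_e1_mem_LinfD hZ₂)
  · intro h t s hts hsT X hX Y hY hle
    obtain ⟨hSm, -, hS1, -⟩ := hS T le_rfl
    have key : ∀ r ≤ T, ∀ V ∈ LinfD F d T,
        pi r (fun ω => dot (S T ω) (V ω) • e1 d) =ᵐ[P] pi r V := fun r hr V hV =>
      (hpi r hr _ (smul_e1_mem_LinfD (dot_mem_Linf hSm hV))).ae_eq_of_dot_eq (hpi r hr V hV)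
        fun ω => dot_smul_e1 _ _ (hS1 ω)
    have htT : t ≤ T := hts.le.trans hsT
    exact (key t htT X hX).symm.le.trans <|
      (h t s hts hsT _ (dot_mem_Linf hSm hX) _ (dot_mem_Linf hSm hY) <|
        (key s hsT X hX).le.trans <| hle.trans (key s hsT Y hY).symm.le).trans
      (key t htT Y hY).le

end RiskPaper
end
end

section
/- In the setting where R_t(X) = (ρ_t(X) + L^∞(F_t;ℝ_+)) e_1 for every X ∈ L^∞_d(F) and every t (i.e. R_t is a 𝕂_t-compatible set-valued conditional convex risk measure with eligible assets M = ℝ×{0}^{d−1} and ρ_t its scalarization), the family (R_t)_{t=0}^T is multiportfolio time consistent if and only if (ρ_t)_{t=0}^T is ρ-time consistent, i.e. for all t < s and X,Y ∈ L^∞_d(F): ρ_s(X) ≤ ρ_s(Y) implies ρ_t(X) ≤ ρ_t(Y). -/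
open MeasureTheory Filter Set
open scoped ENNReal

noncomputable section

namespace RiskPaper

variable {Ω : Type*}

lemma dot_e1_smul_e1 {d : ℕ} (hd : 0 < d) (c : ℝ) : dot (e1 d) (c • e1 d) = c := by
  obtain ⟨n, rfl⟩ := Nat.exists_eq_succ_of_ne_zero hd.ne'
  simp [dot, e1]

lemma smul_e1_mem_Mt {F : ℕ → MeasurableSpace Ω} {d t : ℕ} {g : Ω → ℝ} (hg : g ∈ Linf F t) :
    (fun ω => g ω • e1 d) ∈ Mt F d t := by
  obtain ⟨hm, C, hC⟩ := hg
  refine ⟨⟨?_, C, fun ω i => ?_⟩, fun ω i hi => by simp [e1, hi]⟩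
  · refine @measurable_pi_lambda Ω (Fin d) (fun _ => ℝ) (F t) _ _ fun i => ?_
    exact Measurable.mul_const (m := F t) hm (e1 d i)
  · have h0 : 0 ≤ C := (abs_nonneg _).trans (hC ω)
    by_cases hi : (i : ℕ) = 0
    · simpa [e1, hi] using hC ω
    · simpa [e1, hi] using h0

/-- Cash invariance in the first asset forces the market to have at least one asset. -/
lemma ScalarRM.dim_pos [MeasurableSpace Ω] {F : ℕ → MeasurableSpace Ω} {P : Measure Ω}
    [IsProbabilityMeasure P] {d T t : ℕ} {rho : (Ω → Fin d → ℝ) → Ω → ℝ}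
    (h : ScalarRM F P d T t rho) : 0 < d := by
  by_contra hd
  obtain rfl : d = 0 := by omega
  have h0 : (0 : Ω → Fin 0 → ℝ) ∈ LinfD F 0 T :=
    ⟨@measurable_const _ _ _ (F T) 0, 0, fun _ i => i.elim0⟩
  have h1 : (fun _ => (1 : ℝ)) ∈ Linf F t :=
    ⟨@measurable_const _ _ _ (F t) 1, 1, fun _ => by simp⟩
  obtain ⟨ω, hω⟩ := (h.cash 0 h0 _ h1).exists
  rw [Subsingleton.elim (fun ω => (0 : Ω → Fin 0 → ℝ) ω + (1 : ℝ) • e1 0) 0] at hω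
  linarith

/-- An upper set of the form `(ρ + L^∞(F_r; ℝ_+)) e₁` with `ρ ∈ L^∞(F_r)` has a least element. -/
lemma exists_mem_dot_ae_eq [MeasurableSpace Ω] {F : ℕ → MeasurableSpace Ω} {P : Measure Ω}
    {d r : ℕ} (hd : 0 < d) {f : Ω → ℝ} (hf : ∃ g ∈ Linf F r, f =ᵐ[P] g)
    {S : Set (Ω → Fin d → ℝ)}
    (hS : ∀ u, u ∈ S ↔ u ∈ Mt F d r ∧ ∀ᵐ ω ∂P, f ω ≤ dot (e1 d) (u ω)) :
    ∃ u ∈ S, (fun ω => dot (e1 d) (u ω)) =ᵐ[P] f := by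
  obtain ⟨g, hg, hfg⟩ := hf
  refine ⟨fun ω => g ω • e1 d, (hS _).2 ⟨smul_e1_mem_Mt hg, ?_⟩, ?_⟩
  · filter_upwards [hfg] with ω hω
    rw [dot_e1_smul_e1 hd, hω]
  · filter_upwards [hfg] with ω hω
    rw [dot_e1_smul_e1 hd, hω]

/-- Lemma 6.14.  In the setting where
`R_t(X) = (ρ_t(X) + L^∞(F_t;ℝ_+)) e₁` (i.e. `R_t` is a `𝕂_t`-compatible set-valued
conditional convex risk measure with the single eligible asset `M = ℝ × {0}^{d−1}` and
`ρ_t` its scalarization), the family `(R_t)_t` is multiportfolio time consistent iff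
`(ρ_t)_t` is `ρ`-time consistent. -/
theorem statement19 [MeasurableSpace Ω] (F : ℕ → MeasurableSpace Ω) (P : Measure Ω)
    [IsProbabilityMeasure P] (d T : ℕ) (K : ℕ → Ω → Set (Fin d → ℝ))
    (hFil : FiltrationOK F P T) (hK : ConesOK K) (hKbar : FrictionAssumption P T K)
    (rho : ℕ → (Ω → Fin d → ℝ) → Ω → ℝ)
    (hrho : ∀ r ≤ T, ScalarRM F P d T r (rho r) ∧ KCompat F P d T K r (rho r))
    (R : ℕ → (Ω → Fin d → ℝ) → Set (Ω → Fin d → ℝ))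
    -- `R_t(X) = (ρ_t(X) + L^∞(F_t; ℝ_+)) e₁`:
    (hR : ∀ r ≤ T, ∀ X ∈ LinfD F d T, ∀ u : Ω → Fin d → ℝ,
      u ∈ R r X ↔ u ∈ Mt F d r ∧ ∀ᵐ ω ∂P, rho r X ω ≤ dot (e1 d) (u ω)) :
    -- multiportfolio time consistency of `(R_t)_t` …
    (∀ t s : ℕ, t < s → s ≤ T → ∀ Y ∈ LinfD F d T,
      ∀ XX : Set (Ω → Fin d → ℝ), XX ⊆ LinfD F d T →
      (R s Y ⊆ ⋃ X ∈ XX, R s X) → R t Y ⊆ ⋃ X ∈ XX, R t X) ↔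
    -- … iff `ρ`-time consistency of `(ρ_t)_t`:
    (∀ t s : ℕ, t < s → s ≤ T → ∀ X ∈ LinfD F d T, ∀ Y ∈ LinfD F d T,
      rho s X ≤ᵐ[P] rho s Y → rho t X ≤ᵐ[P] rho t Y) := by
  have hleast : ∀ r ≤ T, ∀ X ∈ LinfD F d T,
      ∃ u ∈ R r X, (fun ω => dot (e1 d) (u ω)) =ᵐ[P] rho r X := fun r hr X hX =>
    exists_mem_dot_ae_eq (hrho r hr).1.dim_pos ((hrho r hr).1.finite X hX) (hR r hr X hX)
  have hle : ∀ r ≤ T, ∀ X ∈ LinfD F d T, ∀ u ∈ R r X,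
      ∀ᵐ ω ∂P, rho r X ω ≤ dot (e1 d) (u ω) := fun r hr X hX u hu =>
    ((hR r hr X hX u).1 hu).2
  have hsub : ∀ r ≤ T, ∀ X ∈ LinfD F d T, ∀ Y ∈ LinfD F d T,
      rho r X ≤ᵐ[P] rho r Y → R r Y ⊆ R r X := by
    intro r hr X hX Y hY h u hu
    exact (hR r hr X hX u).2 ⟨((hR r hr Y hY u).1 hu).1, h.trans (hle r hr Y hY u hu)⟩
  constructor
  · intro h t s hts hs X hX Y hY hXY
    have ht : t ≤ T := hts.le.trans hs
    have hRt : R t Y ⊆ R t X := by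
      simpa using h t s hts hs Y hY {X} (by simpa using hX)
        (by simpa using hsub s hs X hX Y hY hXY)
    obtain ⟨u, hu, hu'⟩ := hleast t ht Y hY
    exact EventuallyLE.trans_eq (hle t ht X hX u (hRt hu)) hu'
  · intro h t s hts hs Y hY XX hXX hU
    have ht : t ≤ T := hts.le.trans hs
    obtain ⟨u, hu, hu'⟩ := hleast s hs Y hY
    obtain ⟨X, hX, huX⟩ := mem_iUnion₂.1 (hU hu)
    exact (hsub t ht X (hXX hX) Y hY <| h t s hts hs X (hXX hX) Y hY <|
      EventuallyLE.trans_eq (hle s hs X (hXX hX) u huX) hu').trans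
        (subset_biUnion_of_mem (u := fun X => R t X) hX)

end RiskPaper
end
end
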